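/- Let \varphi_r(t) = \int_{-\infty}^{\infty} e^{(2t-1)x}/(4x \sinh x \sinh(2x/r)) dx, where the integration contour passes above the singularity at x=0 by a small half circle. Then for 1/r \leq a \leq (r-1)/r, 1 - e^{2\pi i a} = \exp(\varphi_r(a - 1/r) - \varphi_r(a + 1/r)). -/

import Mathlib

open Complex Filter

/-- The integrand of Faddeev's quantum dilogarithm, as a function of a complex
variable. -/
noncomputable def phiIntegrand (r : ℕ) (t : ℝ) (z : ℂ) : ℂ :=
  Complex.exp ((2 * t - 1) * z) / (4 * z * Complex.sinh z * Complex.sinh (2 * z / r))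

/-- Faddeev's quantum dilogarithm `φ_r(t)`: the integral of `phiIntegrand` along
the real line, indented above the singularity at `x = 0` by a small semicircle
in the upper half plane (parametrized by `ε * exp(iθ)`, `θ` from `π` to `0`). -/
noncomputable def quantumDilog (r : ℕ) (t : ℝ) : ℂ :=
  limUnder (nhdsWithin 0 (Set.Ioi (0 : ℝ))) (fun ε : ℝ =>
    (∫ x in Set.Iic (-ε), phiIntegrand r t (x : ℂ)) +
    (-∫ θ in (0:ℝ)..Real.pi,
        I * ε * Complex.exp (I * θ) * phiIntegrand r t (ε * Complex.exp (I * θ))) +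
    ∫ x in Set.Ici ε, phiIntegrand r t (x : ℂ))

open MeasureTheory Set Topology

theorem exists_hasDerivAt_of_differentiableAt_punctured_ball {f : ℂ → ℂ} {R : ℝ} (hR : 0 < R)
    (hf : ∀ z, z ≠ 0 → ‖z‖ < R → DifferentiableAt ℂ f z) :
    ∃ F : ℂ → ℂ, ∀ z, ‖z‖ < R → -I * z ∈ slitPlane → HasDerivAt F (f z) z := by
  have hopen : IsOpen {w : ℂ | w.re < Real.log R} := isOpen_lt continuous_re continuous_const
  obtain ⟨P, hP⟩ := (convex_halfSpace_re_lt (Real.log R)).exists_forall_hasDerivWithinAt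
    (f := fun w : ℂ => exp w * f (exp w)) (𝕜 := ℂ) (by
      intro w hw
      have h : DifferentiableAt ℂ f (exp w) := by
        refine hf _ (exp_ne_zero w) ?_
        rw [norm_exp]
        exact (Real.lt_log_iff_exp_lt hR).1 hw
      exact (differentiableAt_exp.mul (h.comp w differentiableAt_exp)).differentiableWithinAt)
  refine ⟨fun z => P (log (-I * z) + Real.pi / 2 * I), fun z hz hs => ?_⟩
  have hz0 : z ≠ 0 := by
    rintro rfl
    simp at hs
  have he : exp (log (-I * z) + Real.pi / 2 * I) = z := by
    rw [exp_add, exp_log (slitPlane_ne_zero hs), exp_pi_div_two_mul_I]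
    linear_combination (-z) * I_mul_I
  have hmem : log (-I * z) + Real.pi / 2 * I ∈ {w : ℂ | w.re < Real.log R} := by
    rw [mem_ofPred_eq]
    rw [Real.lt_log_iff_exp_lt hR, ← norm_exp, he]
    exact hz
  have h1 := (hP _ hmem).hasDerivAt (hopen.mem_nhds hmem)
  have h2 : HasDerivAt (fun z => log (-I * z) + Real.pi / 2 * I) (-I * 1 / (-I * z)) z :=
    (((hasDerivAt_id z).const_mul (-I)).clog hs).add_const _
  have h3 := h1.comp z h2
  simp only [he] at h3
  convert! h3 using 1
  field_simp

theorem integral_path_eq_sub {f F : ℂ → ℂ} {γ γ' : ℝ → ℂ} {a b : ℝ}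
    (hF : ∀ x ∈ uIcc a b, HasDerivAt F (f (γ x)) (γ x))
    (hf : ∀ x ∈ uIcc a b, ContinuousAt f (γ x))
    (hγ : ∀ x, HasDerivAt γ (γ' x) x) (hγ' : Continuous γ') :
    ∫ x in a..b, γ' x * f (γ x) = F (γ b) - F (γ a) := by
  refine intervalIntegral.integral_eq_sub_of_hasDerivAt (f := F ∘ γ) (fun x hx => ?_) ?_
  · rw [mul_comm]
    exact (hF x hx).comp x (hγ x)
  · refine ContinuousOn.intervalIntegrable fun x hx => ContinuousAt.continuousWithinAt ?_
    exact hγ'.continuousAt.mul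
      (ContinuousAt.comp (f := γ) (hf x hx) (hγ x).continuousAt)

/-- The semicircle of radius `ε` and the three upper sides of a rectangle with the same endpoints
are interchangeable as integration paths. -/
theorem neg_integral_semicircle_eq {f : ℂ → ℂ} {ε : ℝ} (hε : 0 < ε) (hε1 : ε ≤ 1)
    (hf : ∀ z, z ≠ 0 → |z.im| < Real.pi → DifferentiableAt ℂ f z) :
    -∫ θ in (0:ℝ)..Real.pi, I * ε * exp (I * θ) * f (ε * exp (I * θ)) =
      I * (∫ y in (0:ℝ)..(Real.pi / 2), f (-ε + y * I)) +
      (∫ x in (-ε)..ε, f (x + Real.pi / 2 * I)) -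
      I * (∫ y in (0:ℝ)..(Real.pi / 2), f (ε + y * I)) := by
  have hpi := Real.pi_gt_three
  have hpi4 := Real.pi_le_four
  obtain ⟨F, hF⟩ := exists_hasDerivAt_of_differentiableAt_punctured_ball (f := f)
    (R := Real.pi) Real.pi_pos fun z h0 hz => hf z h0 ((abs_im_le_norm z).trans_lt hz)
  have hc : ∀ z, -I * z ∈ slitPlane → ‖z‖ < Real.pi → ContinuousAt f z := fun z hs hz => by
    refine (hf z ?_ ((abs_im_le_norm z).trans_lt hz)).continuousAt
    rintro rfl
    simp at hs
  have hn : ∀ x y : ℝ, |x| ≤ 1 → |y| ≤ Real.pi / 2 → ‖(x : ℂ) + y * I‖ < Real.pi := by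
    intro x y hx hy
    calc ‖(x : ℂ) + y * I‖ ≤ ‖(x : ℂ)‖ + ‖(y : ℂ) * I‖ := norm_add_le _ _
      _ = |x| + |y| := by simp
      _ < Real.pi := by linarith
  have hs : ∀ x y : ℝ, 0 < y ∨ x ≠ 0 → -I * ((x : ℂ) + y * I) ∈ slitPlane := by
    intro x y h
    rw [mem_slitPlane_iff]
    simpa using h
  have h1 : ∫ θ in (0:ℝ)..Real.pi, (I * ε * exp (I * θ)) * f (ε * exp (I * θ)) =
      F (ε * exp (I * Real.pi)) - F (ε * exp (I * (0:ℝ))) := by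
    have key : ∀ θ ∈ uIcc 0 Real.pi, -I * ((ε : ℂ) * exp (I * θ)) ∈ slitPlane ∧
        ‖(ε : ℂ) * exp (I * θ)‖ < Real.pi := by
      intro θ hθ
      rw [uIcc_of_le Real.pi_pos.le] at hθ
      have e : (ε : ℂ) * exp (I * θ) = (ε * Real.cos θ : ℝ) + (ε * Real.sin θ : ℝ) * I := by
        rw [mul_comm I, exp_mul_I]
        push_cast
        ring
      constructor
      · rw [e]
        apply hs
        rcases hθ.1.eq_or_lt with h | h
        · right; subst h; simp [hε.ne']
        rcases hθ.2.eq_or_lt with h' | h'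
        · right; subst h'; simp [hε.ne']
        · left
          exact mul_pos hε (Real.sin_pos_of_pos_of_lt_pi h h')
      · rw [norm_mul, mul_comm I, norm_exp_ofReal_mul_I, norm_real, Real.norm_eq_abs,
          abs_of_pos hε]
        linarith
    refine integral_path_eq_sub (γ := fun θ : ℝ => (ε : ℂ) * exp (I * θ))
      (γ' := fun θ : ℝ => I * ε * exp (I * θ)) (fun x hx => hF _ (key x hx).2 (key x hx).1)
      (fun x hx => hc _ (key x hx).1 (key x hx).2) (fun x => ?_) (by fun_prop)
    have := (((ofRealCLM.hasDerivAt (x := x)).const_mul I).cexp).const_mul (ε : ℂ)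
    convert! this using 1
    simp
    ring
  have h2 : ∀ x : ℝ, |x| ≤ 1 → x ≠ 0 →
      ∫ y in (0:ℝ)..(Real.pi / 2), I * f (x + y * I) =
        F (x + (Real.pi / 2 : ℝ) * I) - F (x + (0 : ℝ) * I) := by
    intro x hx hx0
    have key : ∀ y ∈ uIcc 0 (Real.pi / 2), |y| ≤ Real.pi / 2 := by
      intro y hy
      rw [uIcc_of_le (by linarith)] at hy
      rw [abs_of_nonneg hy.1]
      exact hy.2
    refine integral_path_eq_sub (γ := fun y : ℝ => (x : ℂ) + y * I)
      (γ' := fun y : ℝ => I)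
      (fun y hy => hF _ (hn x y hx (key y hy)) (hs x y (.inr hx0)))
      (fun y hy => hc _ (hs x y (.inr hx0)) (hn x y hx (key y hy))) (fun y => ?_) (by fun_prop)
    simpa using ((ofRealCLM.hasDerivAt (x := y)).mul_const I).const_add (x : ℂ)
  have h3 : ∫ x in (-ε)..ε, 1 * f (x + Real.pi / 2 * I) =
      F ((ε : ℝ) + (Real.pi / 2 : ℂ) * I) - F ((-ε : ℝ) + (Real.pi / 2 : ℂ) * I) := by
    have key : ∀ x ∈ uIcc (-ε) ε, |x| ≤ 1 := by
      intro x hx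
      rw [uIcc_of_le (by linarith)] at hx
      rw [abs_le]
      constructor <;> linarith [hx.1, hx.2]
    have hh : |Real.pi / 2| ≤ Real.pi / 2 := by rw [abs_of_pos (by positivity)]
    have h0 : 0 < Real.pi / 2 := by positivity
    refine integral_path_eq_sub (γ := fun x : ℝ => (x : ℂ) + Real.pi / 2 * I)
      (γ' := fun y : ℝ => 1)
      (fun x hx => hF _ (mod_cast hn x _ (key x hx) hh) (mod_cast hs x _ (.inl h0)))
      (fun x hx => hc _ (mod_cast hs x _ (.inl h0)) (mod_cast hn x _ (key x hx) hh))
      (fun y => ?_) (by fun_prop)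
    simpa using (ofRealCLM.hasDerivAt (x := y)).add_const (Real.pi / 2 * I : ℂ)
  have h4 := h2 ε (by rwa [abs_of_pos hε]) hε.ne'
  have h5 := h2 (-ε) (by rwa [abs_neg, abs_of_pos hε]) (neg_ne_zero.2 hε.ne')
  rw [intervalIntegral.integral_const_mul] at h4 h5
  simp only [one_mul] at h3
  have e1 : exp (I * Real.pi) = -1 := by rw [mul_comm, exp_pi_mul_I]
  rw [h1, h3, h4]
  push_cast at h5 ⊢
  rw [h5, e1]
  simp

/-- Cauchy's theorem for a half strip on which the function decays exponentially. -/
theorem integral_Ioi_eq_integral_Ioi_shift {f : ℂ → ℂ} {x₀ c C b : ℝ} (hb : 0 < b)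
    (hd : ∀ z : ℂ, x₀ ≤ z.re → |z.im| ≤ |c| → DifferentiableAt ℂ f z)
    (hbd : ∀ z : ℂ, x₀ ≤ z.re → |z.im| ≤ |c| → ‖f z‖ ≤ C * Real.exp (-b * z.re)) :
    (∫ x in Ioi x₀, f (x : ℂ)) = (∫ x in Ioi x₀, f (x + c * I)) +
      I * ∫ y in (0:ℝ)..c, f (x₀ + y * I) := by
  have hint : ∀ y : ℝ, |y| ≤ |c| → IntegrableOn (fun x : ℝ => f (x + y * I)) (Ioi x₀) := by
    intro y hy
    refine Integrable.mono' ((integrableOn_exp_mul_Ioi (neg_lt_zero.2 hb) x₀).const_mul C) ?_ ?_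
    · refine ContinuousOn.aestronglyMeasurable (fun x hx => ?_) measurableSet_Ioi
      refine ContinuousAt.continuousWithinAt ?_
      refine ContinuousAt.comp (f := fun x : ℝ => (x : ℂ) + y * I)
        (hd _ ?_ ?_).continuousAt (by fun_prop)
      · simpa using (mem_Ioi.1 hx).le
      · simpa using hy
    · refine (ae_restrict_iff' measurableSet_Ioi).2 (ae_of_all _ fun x hx => ?_)
      simpa using hbd (x + y * I) (by simpa using (mem_Ioi.1 hx).le) (by simpa using hy)
  have hrect : ∀ R, x₀ ≤ R → (∫ x in x₀..R, f (x : ℂ)) - (∫ x in x₀..R, f (x + c * I)) +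
      I * (∫ y in (0:ℝ)..c, f (R + y * I)) - I * (∫ y in (0:ℝ)..c, f (x₀ + y * I)) = 0 := by
    intro R hR
    have := Complex.integral_boundary_rect_eq_zero_of_differentiableOn f (x₀ : ℂ) (R + c * I) (by
      intro z hz
      rw [mem_reProdIm] at hz
      simp only [ofReal_re, add_re, mul_re, I_re, ofReal_im, I_im, add_im, mul_im] at hz
      norm_num at hz
      refine (hd z ?_ ?_).differentiableWithinAt
      · rw [uIcc_of_le hR] at hz
        exact hz.1.1
      · simpa using abs_sub_left_of_mem_uIcc hz.2)
    simpa using this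
  have t0 := intervalIntegral_tendsto_integral_Ioi x₀ (by simpa using hint 0 (by simp)) tendsto_id
  have t1 := intervalIntegral_tendsto_integral_Ioi x₀ (hint c le_rfl) tendsto_id
  have t2 : Tendsto (fun R : ℝ => ∫ y in (0:ℝ)..c, f (R + y * I)) atTop (𝓝 0) := by
    rw [tendsto_zero_iff_norm_tendsto_zero]
    have hz : Tendsto (fun R : ℝ => C * Real.exp (-b * R) * |c - 0|) atTop (𝓝 0) := by
      have : Tendsto (fun R : ℝ => Real.exp (-b * R)) atTop (𝓝 0) :=
        Real.tendsto_exp_atBot.comp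
          (tendsto_id.const_mul_atTop_of_neg (neg_lt_zero.2 hb))
      simpa using (this.const_mul C).mul_const |c - 0|
    refine squeeze_zero' (Eventually.of_forall fun _ => norm_nonneg _) ?_ hz
    filter_upwards [eventually_ge_atTop x₀] with R hR
    refine intervalIntegral.norm_integral_le_of_norm_le_const fun y hy => ?_
    have hy' := abs_sub_left_of_mem_uIcc (uIoc_subset_uIcc hy)
    simpa using hbd (R + y * I) (by simpa using hR) (by simpa using hy')
  have t3 := ((t0.sub t1).add (t2.const_mul I)).sub_const
    (I * (∫ y in (0:ℝ)..c, f (x₀ + y * I)))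
  have t4 := tendsto_nhds_unique (t3.congr' (f₂ := fun _ => (0:ℂ)) (by
    filter_upwards [eventually_ge_atTop x₀] with R hR
    exact hrect R hR)) tendsto_const_nhds
  linear_combination t4

/-- The indented contour can be pushed up to the horizontal line of height `π / 2`. -/
theorem indented_integral_eq_shift {f : ℂ → ℂ} {ε C b : ℝ} (hε : 0 < ε) (hε1 : ε ≤ 1) (hb : 0 < b)
    (hf : ∀ z, z ≠ 0 → |z.im| < Real.pi → DifferentiableAt ℂ f z)
    (hbd : ∀ z : ℂ, ε ≤ |z.re| → |z.im| ≤ Real.pi / 2 → ‖f z‖ ≤ C * Real.exp (-b * |z.re|)) :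
    Integrable (fun x : ℝ => f (x + Real.pi / 2 * I)) ∧
    (∫ x in Iic (-ε), f (x : ℂ)) +
      (-∫ θ in (0:ℝ)..Real.pi, I * ε * exp (I * θ) * f (ε * exp (I * θ))) +
      ∫ x in Ici ε, f (x : ℂ) = ∫ x : ℝ, f (x + Real.pi / 2 * I) := by
  have hpi := Real.pi_pos
  have hp2 : |Real.pi / 2| = Real.pi / 2 := abs_of_pos (by positivity)
  have hcont : Continuous (fun x : ℝ => f (x + Real.pi / 2 * I)) := by
    rw [continuous_iff_continuousAt]
    intro x
    have him : ((x : ℂ) + Real.pi / 2 * I).im = Real.pi / 2 := by simp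
    refine ContinuousAt.comp (f := fun x : ℝ => (x : ℂ) + Real.pi / 2 * I)
      (hf _ ?_ ?_).continuousAt (by fun_prop)
    · intro h
      rw [h] at him
      simp at him
      linarith
    · rw [him, hp2]
      linarith
  have hbd' : ∀ x : ℝ, ε ≤ |x| →
      ‖f (x + Real.pi / 2 * I)‖ ≤ C * Real.exp (-b * |x|) := fun x hx => by
    simpa using hbd (x + Real.pi / 2 * I) (by simpa using hx) (by simp [hp2])
  have hi1 : IntegrableOn (fun x : ℝ => f (x + Real.pi / 2 * I)) (Iic (-ε)) := by
    refine Integrable.mono' ((integrableOn_exp_mul_Iic hb (-ε)).const_mul C)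
      hcont.aestronglyMeasurable ?_
    refine (ae_restrict_iff' measurableSet_Iic).2 (ae_of_all _ fun x hx => ?_)
    have hx' : x ≤ -ε := hx
    have := hbd' x (by rw [abs_of_neg (by linarith)]; linarith)
    rwa [abs_of_neg (by linarith), neg_mul_neg] at this
  have hi2 : IntegrableOn (fun x : ℝ => f (x + Real.pi / 2 * I)) (Ioi ε) := by
    refine Integrable.mono' ((integrableOn_exp_mul_Ioi (neg_lt_zero.2 hb) ε).const_mul C)
      hcont.aestronglyMeasurable ?_
    refine (ae_restrict_iff' measurableSet_Ioi).2 (ae_of_all _ fun x hx => ?_)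
    have hx' : ε < x := hx
    have := hbd' x (by rw [abs_of_pos (by linarith)]; linarith)
    rwa [abs_of_pos (by linarith)] at this
  have hi3 : IntegrableOn (fun x : ℝ => f (x + Real.pi / 2 * I)) (Ioi (-ε)) := by
    rw [← Ioc_union_Ioi_eq_Ioi (show -ε ≤ ε by linarith)]
    exact (hcont.integrableOn_Ioc).union hi2
  have hi : Integrable (fun x : ℝ => f (x + Real.pi / 2 * I)) := by
    rw [← integrableOn_univ, ← Iic_union_Ioi (a := -ε)]
    exact hi1.union hi3
  refine ⟨hi, ?_⟩
  have hr := integral_Ioi_eq_integral_Ioi_shift (f := f) (x₀ := ε) (c := Real.pi / 2) (C := C) hb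
    (fun z h1 h2 => hf z (by rintro rfl; simp at h1; linarith) (by rw [hp2] at h2; linarith))
    (fun z h1 h2 => by
      have h3 : 0 < z.re := by linarith
      simpa [abs_of_pos h3] using hbd z (by rwa [abs_of_pos h3]) (by rwa [hp2] at h2))
  have hl := integral_Ioi_eq_integral_Ioi_shift (f := fun z => f (-z)) (x₀ := ε)
    (c := -(Real.pi / 2)) (C := C) hb
    (fun z h1 h2 => by
      have h0 : z ≠ 0 := by rintro rfl; simp at h1; linarith
      have : DifferentiableAt ℂ f (-z) :=
        hf (-z) (neg_ne_zero.2 h0) (by rw [abs_neg, hp2] at h2; simp; linarith)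
      exact this.comp z differentiableAt_id.neg)
    (fun z h1 h2 => by
      have h3 : 0 < z.re := by linarith
      simpa [abs_of_pos h3] using hbd (-z) (by simpa [abs_of_pos h3] using h1)
        (by simpa [hp2] using h2))
  have hl1 : ∫ x in Iic (-ε), f (x : ℂ) = ∫ x in Ioi ε, f (-(x : ℂ)) := by
    rw [← neg_neg ε, ← integral_comp_neg_Iic]
    simp
  have hl2 : ∫ x in Iic (-ε), f (x + Real.pi / 2 * I) =
      ∫ x in Ioi ε, f (-((x : ℂ) + (-(Real.pi / 2) : ℝ) * I)) := by
    have := integral_comp_neg_Ioi ε (fun x : ℝ => f (x + Real.pi / 2 * I))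
    rw [← this]
    refine integral_congr_ae (ae_of_all _ fun x => ?_)
    simp only
    congr 1
    push_cast
    ring
  have hl3 : ∫ y in (0:ℝ)..(-(Real.pi / 2)), f (-((ε : ℂ) + y * I)) =
      -∫ y in (0:ℝ)..(Real.pi / 2), f (-ε + y * I) := by
    have := intervalIntegral.integral_comp_neg (a := 0) (b := Real.pi / 2)
      (fun y : ℝ => f (-((ε : ℂ) + y * I)))
    rw [neg_zero] at this
    rw [intervalIntegral.integral_symm, ← this]
    congr 1
    refine intervalIntegral.integral_congr fun x _ => ?_
    congr 1
    push_cast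
    ring
  rw [← hl1, ← hl2, hl3] at hl
  rw [integral_Ici_eq_integral_Ioi, hl, hr, neg_integral_semicircle_eq hε hε1 hf]
  have hsum := intervalIntegral.integral_Iic_add_Ioi hi1 hi3
  have hsum2 := intervalIntegral.integral_interval_add_Ioi hi3 hi2
  rw [← hsum, ← hsum2]
  push_cast
  ring

theorem integrable_exp_div_cosh_and_integral_eq {α : ℂ} (h0 : 0 < α.re) (h1 : α.re < 1) :
    Integrable (fun x : ℝ => exp ((2 * α - 1) * x) / cosh (x : ℂ)) ∧
      ∫ x : ℝ, exp ((2 * α - 1) * x) / cosh (x : ℂ) = Real.pi / sin (Real.pi * α) := by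
  have h1' : 0 < (1 - α).re := by simpa using h1
  set g : ℝ → ℂ := fun x => (x : ℂ) ^ (α - 1) * (1 - (x : ℂ)) ^ ((1 - α) - 1) with hg
  set s : ℝ → ℝ := fun y => Real.sigmoid (2 * y) with hs
  set s' : ℝ → ℝ := fun y => 2 * (Real.sigmoid (2 * y) * (1 - Real.sigmoid (2 * y))) with hs'
  have hder : ∀ x ∈ (univ : Set ℝ), HasDerivWithinAt s (s' x) univ x := by
    intro x _
    have := (Real.hasDerivAt_sigmoid (2 * x)).comp x ((hasDerivAt_id x).const_mul 2)
    refine HasDerivAt.hasDerivWithinAt ?_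
    convert! this using 1
    simp only [hs', mul_one]
    ring
  have hinj : InjOn s univ := fun x _ y _ h => by
    have := Real.sigmoid_injective h
    linarith
  have himg : s '' univ = Ioo 0 1 := by
    rw [image_univ, ← Real.range_sigmoid]
    exact (mul_left_surjective₀ (two_ne_zero (α := ℝ))).range_comp Real.sigmoid
  have hpt : ∀ x : ℝ, |s' x| • g (s x) = exp ((2 * α - 1) * x) / cosh (x : ℂ) := by
    intro x
    have hσ0 := Real.sigmoid_pos (2 * x)
    have hσ1 : 0 < 1 - Real.sigmoid (2 * x) := sub_pos.2 (Real.sigmoid_lt_one _)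
    have hc : (cosh (x : ℂ)) ≠ 0 := by
      rw [← ofReal_cosh]
      exact_mod_cast (Real.cosh_pos x).ne'
    have hτ : 1 - Real.sigmoid (2 * x) = (1 + Real.exp (2 * x))⁻¹ := by
      rw [← Real.sigmoid_neg, Real.sigmoid_def, neg_neg]
    have hσ : Real.sigmoid (2 * x) = Real.exp (2 * x) * (1 - Real.sigmoid (2 * x)) := by
      rw [hτ, Real.sigmoid_def, Real.exp_neg]
      have := Real.exp_pos (2 * x)
      field_simp
      ring
    have hlog : Real.log (Real.sigmoid (2 * x)) = 2 * x + Real.log (1 - Real.sigmoid (2 * x)) := by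
      conv_lhs => rw [hσ]
      rw [Real.log_mul (Real.exp_ne_zero _) hσ1.ne', Real.log_exp]
    have e1 : ((Real.sigmoid (2 * x) : ℝ) : ℂ) = exp (Real.log (Real.sigmoid (2 * x)) : ℝ) := by
      rw [← ofReal_exp, Real.exp_log hσ0]
    have e2 : ((1 - Real.sigmoid (2 * x) : ℝ) : ℂ) =
        exp (Real.log (1 - Real.sigmoid (2 * x)) : ℝ) := by
      rw [← ofReal_exp, Real.exp_log hσ1]
    have e3 : 2 * ((1 - Real.sigmoid (2 * x) : ℝ) : ℂ) * exp (x : ℂ) = 1 / cosh (x : ℂ) := by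
      rw [hτ]
      have hpos := Real.exp_pos (2 * x)
      have hne : (1 + exp (2 * x : ℂ)) ≠ 0 := by
        have : (1 + Real.exp (2 * x)) ≠ 0 := by positivity
        exact_mod_cast this
      push_cast
      rw [eq_div_iff hc, cosh, exp_neg]
      have e : exp (2 * x : ℂ) = exp (x : ℂ) ^ 2 := by rw [← exp_nat_mul]; norm_cast
      have hx := exp_ne_zero (x : ℂ)
      rw [e] at hne ⊢
      field_simp
      ring
    have hs'pos : 0 < s' x := by simp only [hs']; positivity
    rw [abs_of_pos hs'pos, real_smul]
    have hL : ((s' x : ℝ) : ℂ) = 2 * (exp (Real.log (Real.sigmoid (2 * x)) : ℝ) *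
        exp (Real.log (1 - Real.sigmoid (2 * x)) : ℝ)) := by
      rw [← e1, ← e2]
      simp [hs']
    have hG : g (s x) = exp ((Real.log (Real.sigmoid (2 * x)) : ℝ) * (α - 1)) *
        exp ((Real.log (1 - Real.sigmoid (2 * x)) : ℝ) * (1 - α - 1)) := by
      simp only [hg, hs]
      rw [← ofReal_one, ← ofReal_sub, cpow_def_of_ne_zero (by exact_mod_cast hσ0.ne'),
        cpow_def_of_ne_zero (by exact_mod_cast hσ1.ne'), ofReal_log hσ0.le, ofReal_log hσ1.le]
    rw [hL, hG, hlog]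
    calc _ = 2 * exp (Real.log (1 - Real.sigmoid (2 * x)) : ℝ) * exp (x : ℂ) *
          exp ((2 * α - 1) * x) := by
          simp only [mul_assoc, ← exp_add]
          congr 2
          push_cast
          ring
      _ = _ := by
          rw [← e2, e3]
          ring
  constructor
  · have hi := betaIntegral_convergent h0 h1'
    rw [intervalIntegrable_iff_integrableOn_Ioo_of_le zero_le_one, ← himg,
      integrableOn_image_iff_integrableOn_abs_deriv_smul MeasurableSet.univ hder hinj,
      integrableOn_univ] at hi
    exact hi.congr (ae_of_all _ hpt)
  · have hb : betaIntegral α (1 - α) = ∫ x : ℝ, exp ((2 * α - 1) * x) / cosh (x : ℂ) := by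
      rw [betaIntegral, intervalIntegral.integral_of_le zero_le_one, integral_Ioc_eq_integral_Ioo,
        ← himg, integral_image_eq_integral_abs_deriv_smul MeasurableSet.univ hder hinj,
        setIntegral_univ]
      exact integral_congr_ae (ae_of_all _ hpt)
    rw [← hb, ← Complex.Gamma_mul_Gamma_one_sub, Gamma_mul_Gamma_eq_betaIntegral h0 h1']
    simp

theorem one_sub_mul_exp_mem_slitPlane {a : ℝ} (h0 : 0 < a) (h1 : a < 1) {u : ℝ} (hu : u ≤ 0) :
    1 - exp (2 * Real.pi * I * a) * exp u ∈ slitPlane := by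
  rw [mem_slitPlane_iff]
  left
  have e : exp (2 * Real.pi * I * a) * exp u = ((Real.exp u : ℝ) : ℂ) *
      exp ((2 * Real.pi * a : ℝ) * I) := by
    rw [mul_comm, ofReal_exp]
    congr 2
    push_cast
    ring
  rw [e, sub_re, one_re, re_ofReal_mul, exp_ofReal_mul_I_re]
  have hu1 : Real.exp u ≤ 1 := Real.exp_le_one_iff.2 hu
  have hu0 := Real.exp_pos u
  have hs : 0 < Real.sin (Real.pi * a) := by
    apply Real.sin_pos_of_pos_of_lt_pi
    · exact mul_pos Real.pi_pos h0
    · nlinarith [Real.pi_pos]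
  have hc : Real.cos (2 * Real.pi * a) < 1 := by
    rw [mul_assoc, Real.cos_two_mul, Real.cos_sq']
    nlinarith
  nlinarith

/-- The Fourier-type integral for the logarithm of `1 - exp (2πia)`. -/
theorem integral_exp_div_mul_sinh_eq {a : ℝ} (h0 : 0 < a) (h1 : a < 1) :
    ∫ x : ℝ, exp ((2 * a - 1) * (x + Real.pi / 2 * I)) /
      (2 * (x + Real.pi / 2 * I) * sinh (x + Real.pi / 2 * I)) =
      -log (1 - exp (2 * Real.pi * I * a)) := by
  have hpi := Real.pi_pos
  set w := exp (2 * Real.pi * I * a) with hw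
  have hcosh : ∀ x : ℝ, cosh (x : ℂ) ≠ 0 := fun x => by
    rw [← ofReal_cosh]
    exact_mod_cast (Real.cosh_pos x).ne'
  have hsinh : ∀ x : ℝ, sinh (x + Real.pi / 2 * I) = I * cosh x := fun x => by
    rw [sinh_add, cosh_mul_I, sinh_mul_I, cos_pi_div_two, sin_pi_div_two]
    ring
  set F : ℝ → ℝ → ℂ := fun x s =>
    -(1 / 2) * exp ((2 * a - 1 + I * s) * (x + Real.pi / 2 * I)) / cosh (x : ℂ) with hF
  have hFint : Integrable (Function.uncurry F) (volume.prod (volume.restrict (Ioi (0:ℝ)))) := by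
    have hA := (integrable_exp_div_cosh_and_integral_eq (α := (a : ℂ)) (by simpa) (by simpa)).1.norm
    have hB : IntegrableOn (fun s : ℝ => Real.exp (-(Real.pi / 2) * s)) (Ioi 0) :=
      integrableOn_exp_mul_Ioi (by linarith) 0
    refine (hA.mul_prod hB).mono' ?_ (ae_of_all _ fun p => ?_)
    · refine Continuous.aestronglyMeasurable ?_
      simp only [hF, Function.uncurry_def]
      refine Continuous.div (by fun_prop) (by fun_prop) fun p => hcosh p.1
    · simp only [hF, Function.uncurry_def, norm_div, norm_mul, norm_exp, norm_neg]
      have e1 : ((2 * (a : ℂ) - 1 + I * p.2) * (p.1 + Real.pi / 2 * I)).re =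
          ((2 * (a : ℂ) - 1) * p.1).re + -(Real.pi / 2) * p.2 := by
        simp
        ring
      rw [e1, Real.exp_add]
      have h2 : ‖(1 : ℂ)‖ / ‖(2 : ℂ)‖ = 1 / 2 := by norm_num
      rw [h2, div_mul_eq_mul_div (Real.exp _)]
      refine div_le_div_of_nonneg_right ?_ (norm_nonneg _)
      have h3 := Real.exp_pos ((2 * (a : ℂ) - 1) * p.1).re
      have h4 := Real.exp_pos (-(Real.pi / 2) * p.2)
      nlinarith [mul_pos h3 h4]
  have hleft : ∀ x : ℝ, ∫ s in Ioi (0:ℝ), F x s =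
      exp ((2 * a - 1) * (x + Real.pi / 2 * I)) /
      (2 * (x + Real.pi / 2 * I) * sinh (x + Real.pi / 2 * I)) := by
    intro x
    have hz : (x + Real.pi / 2 * I : ℂ) ≠ 0 := by
      intro h
      have := congrArg im h
      simp at this
    have hi := integral_exp_mul_complex_Ioi (a := I * (x + Real.pi / 2 * I)) (by simp; linarith) 0
    have e : ∀ s : ℝ, F x s = (-(1 / 2) * exp ((2 * a - 1) * (x + Real.pi / 2 * I)) / cosh (x : ℂ))
        * exp (I * (x + Real.pi / 2 * I) * s) := by
      intro s
      simp only [hF]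
      rw [show (2 * a - 1 + I * s) * (x + Real.pi / 2 * I) =
        (2 * a - 1) * (x + Real.pi / 2 * I) + I * (x + Real.pi / 2 * I) * s by ring, exp_add]
      ring
    simp_rw [e]
    rw [integral_const_mul, hi, hsinh]
    have := hcosh x
    have hI := I_ne_zero
    simp
    field_simp
  have hright : ∀ s : ℝ, ∫ x : ℝ, F x s =
      Real.pi * (w * exp (-Real.pi * s : ℝ)) / (1 - w * exp (-Real.pi * s : ℝ)) := by
    intro s
    set α : ℂ := a + I * s / 2 with hα
    have hre : α.re = a := by simp [hα]
    have hK := (integrable_exp_div_cosh_and_integral_eq (α := α) (by rwa [hre]) (by rwa [hre])).2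
    have e : ∀ x : ℝ, F x s = (-(1 / 2) * exp ((2 * α - 1) * (Real.pi / 2 * I))) *
        (exp ((2 * α - 1) * x) / cosh (x : ℂ)) := by
      intro x
      simp only [hF]
      rw [mul_div_assoc', mul_assoc, ← exp_add]
      congr 3
      simp only [hα]
      ring
    simp_rw [e]
    rw [integral_const_mul, hK]
    have e2 : w * exp (-Real.pi * s : ℝ) = exp (Real.pi * α * I) ^ 2 := by
      rw [hw, ← exp_add, ← exp_nat_mul]
      congr 1
      push_cast
      linear_combination (-Real.pi * s : ℂ) * I_mul_I
    have e3 : exp ((2 * α - 1) * (Real.pi / 2 * I)) = -I * exp (Real.pi * α * I) := by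
      rw [show (2 * α - 1) * (Real.pi / 2 * I) = -(Real.pi / 2 * I) + Real.pi * α * I by ring,
        exp_add, exp_neg, exp_pi_div_two_mul_I, inv_I]
    rw [e2, e3, sin, neg_mul (Real.pi * α) I, exp_neg]
    have hE := exp_ne_zero (Real.pi * α * I)
    set E := exp (Real.pi * α * I)
    by_cases hd : 1 - E ^ 2 = 0
    · have : E⁻¹ - E = 0 := by field_simp; simpa using hd
      rw [hd, this]
      simp
    · have : E⁻¹ - E ≠ 0 := by
        intro h
        apply hd
        field_simp at h
        simpa using h
      have hI := I_ne_zero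
      field_simp
  have hGint : IntegrableOn (fun s : ℝ => Real.pi * (w * exp (-Real.pi * s : ℝ)) /
      (1 - w * exp (-Real.pi * s : ℝ))) (Ioi 0) := by
    have := hFint.integral_prod_right
    simp only [Function.uncurry_apply_pair, hright] at this
    exact this
  have hderiv : ∀ s ∈ Ici (0:ℝ), HasDerivAt
      (fun s : ℝ => log (1 - w * exp (-Real.pi * s : ℝ)))
      (Real.pi * (w * exp (-Real.pi * s : ℝ)) / (1 - w * exp (-Real.pi * s : ℝ))) s := by
    intro s hs
    have hmem := one_sub_mul_exp_mem_slitPlane h0 h1 (u := -Real.pi * s)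
      (by nlinarith [mem_Ici.1 hs])
    have h2 : HasDerivAt (fun s : ℝ => ((-Real.pi * s : ℝ) : ℂ)) (-Real.pi : ℂ) s := by
      have := ((hasDerivAt_id s).const_mul (-Real.pi)).ofReal_comp
      simpa using this
    have h3 := ((h2.cexp.const_mul w).const_sub 1).clog_real hmem
    convert! h3 using 1
    ring
  have hlim : Tendsto (fun s : ℝ => log (1 - w * exp (-Real.pi * s : ℝ))) atTop (𝓝 0) := by
    have t1 : Tendsto (fun s : ℝ => exp (-Real.pi * s : ℝ)) atTop (𝓝 0) := by
      rw [tendsto_exp_nhds_zero_iff]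
      simpa using tendsto_id.const_mul_atTop_of_neg (neg_lt_zero.2 hpi)
    have t2 : Tendsto (fun s : ℝ => 1 - w * exp (-Real.pi * s : ℝ)) atTop (𝓝 1) := by
      simpa using (t1.const_mul w).const_sub 1
    simpa using t2.clog one_mem_slitPlane
  simp_rw [← hleft]
  rw [integral_integral_swap hFint]
  simp_rw [hright]
  rw [integral_Ioi_of_hasDerivAt_of_tendsto' hderiv hGint hlim]
  simp

theorem sinh_ne_zero_of_abs_im_lt_pi {z : ℂ} (hz : z ≠ 0) (him : |z.im| < Real.pi) :
    sinh z ≠ 0 := by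
  intro h
  have h1 : sin (z * I) = 0 := by rw [sin_mul_I, h, zero_mul]
  obtain ⟨k, hk⟩ := sin_eq_zero_iff.1 h1
  have h2 : -z.im = k * Real.pi := by
    have := congrArg re hk
    simpa using this
  have h3 : |(k : ℝ)| < 1 := by
    rw [← abs_neg, h2, abs_mul, abs_of_pos Real.pi_pos] at him
    nlinarith [Real.pi_pos]
  have h4 : k = 0 := by
    have : |k| < 1 := by exact_mod_cast h3
    exact Int.abs_lt_one_iff.1 this
  rw [h4] at hk
  simp [hz] at hk

theorem sinh_two_mul_div_ne_zero {r : ℕ} (hr : 3 ≤ r) {z : ℂ} (hz : z ≠ 0)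
    (him : |z.im| < Real.pi) : sinh (2 * z / r) ≠ 0 := by
  have hr3 : (3 : ℝ) ≤ r := by exact_mod_cast hr
  have hr0 : (r : ℂ) ≠ 0 := by
    have : r ≠ 0 := by omega
    exact_mod_cast this
  refine sinh_ne_zero_of_abs_im_lt_pi (by simp [hz, hr0]) ?_
  have : (2 * z / r : ℂ).im = 2 / r * z.im := by
    have e : (2 * z / r : ℂ) = ((2 / r : ℝ) : ℂ) * z := by push_cast; ring
    rw [e, im_ofReal_mul]
  rw [this, abs_mul, abs_of_pos (by positivity)]
  have h2 : (2 / r : ℝ) ≤ 1 := by rw [div_le_one (by positivity)]; linarith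
  nlinarith [abs_nonneg z.im]

theorem differentiableAt_phiIntegrand {r : ℕ} (hr : 3 ≤ r) (t : ℝ) {z : ℂ} (hz : z ≠ 0)
    (him : |z.im| < Real.pi) : DifferentiableAt ℂ (phiIntegrand r t) z := by
  have h1 := sinh_ne_zero_of_abs_im_lt_pi hz him
  have h2 := sinh_two_mul_div_ne_zero hr hz him
  unfold phiIntegrand
  refine DifferentiableAt.div (by fun_prop) (by fun_prop) ?_
  simp [hz, h1, h2]

theorem le_norm_sinh {z : ℂ} {δ : ℝ} (h : δ ≤ |z.re|) :
    Real.exp |z.re| * ((1 - Real.exp (-2 * δ)) / 2) ≤ ‖sinh z‖ := by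
  have h1 : |Real.exp z.re - Real.exp (-z.re)| ≤ 2 * ‖sinh z‖ := by
    have := abs_norm_sub_norm_le (exp z) (exp (-z))
    rw [norm_exp, norm_exp, neg_re] at this
    refine this.trans_eq ?_
    rw [← two_sinh, norm_mul, Complex.norm_ofNat]
  have h2 : |Real.exp z.re - Real.exp (-z.re)| = Real.exp |z.re| - Real.exp (-|z.re|) := by
    rcases le_total 0 z.re with hz | hz
    · rw [abs_of_nonneg hz, abs_of_nonneg]
      rw [sub_nonneg, Real.exp_le_exp]
      linarith
    · rw [abs_of_nonpos hz, neg_neg, abs_of_nonpos]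
      · ring
      · rw [sub_nonpos, Real.exp_le_exp]
        linarith
  have h3 : Real.exp (-|z.re|) ≤ Real.exp |z.re| * Real.exp (-2 * δ) := by
    rw [← Real.exp_add, Real.exp_le_exp]
    linarith
  linarith

theorem norm_phiIntegrand_le {r : ℕ} (hr : 3 ≤ r) {t : ℝ} (ht0 : 0 ≤ t) (ht1 : t ≤ 1) {ε : ℝ}
    (hε : 0 < ε) : ∃ C : ℝ, ∀ z : ℂ, ε ≤ |z.re| → |z.im| ≤ Real.pi / 2 →
      ‖phiIntegrand r t z‖ ≤ C * Real.exp (-(2 / r) * |z.re|) := by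
  have hr0 : (0 : ℝ) < r := by
    have : 0 < r := by omega
    exact_mod_cast this
  set k₁ := (1 - Real.exp (-2 * ε)) / 2 with hk₁
  set k₂ := (1 - Real.exp (-2 * (2 / r * ε))) / 2 with hk₂
  have hk₁0 : 0 < k₁ := by
    have : Real.exp (-2 * ε) < 1 := Real.exp_lt_one_iff.2 (by linarith)
    linarith
  have hk₂0 : 0 < k₂ := by
    have h2 : 0 < 2 / r * ε := by positivity
    have : Real.exp (-2 * (2 / r * ε)) < 1 := Real.exp_lt_one_iff.2 (by linarith)
    linarith
  refine ⟨Real.exp Real.pi / (4 * ε * k₁ * k₂), fun z hz him => ?_⟩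
  have e : (2 * z / r : ℂ).re = 2 / r * z.re := by
    have e : (2 * z / r : ℂ) = ((2 / r : ℝ) : ℂ) * z := by push_cast; ring
    rw [e, re_ofReal_mul]
  have e' : |(2 * z / r : ℂ).re| = 2 / r * |z.re| := by
    rw [e, abs_mul, abs_of_pos (by positivity)]
  have b1 := le_norm_sinh hz
  have b2 := le_norm_sinh (z := 2 * z / r) (δ := 2 / r * ε) (by rw [e']; gcongr)
  rw [e'] at b2
  have b3 : ε ≤ ‖z‖ := hz.trans (abs_re_le_norm z)
  have b4 : ‖exp ((2 * t - 1) * z)‖ ≤ Real.exp |z.re| := by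
    rw [norm_exp, Real.exp_le_exp]
    have e : ((2 * t - 1) * z : ℂ).re = (2 * t - 1) * z.re := by simp
    rw [e]
    have h3 : |2 * t - 1| ≤ 1 := by rw [abs_le]; constructor <;> linarith
    calc (2 * t - 1) * z.re ≤ |(2 * t - 1) * z.re| := le_abs_self _
      _ = |2 * t - 1| * |z.re| := abs_mul _ _
      _ ≤ 1 * |z.re| := by gcongr
      _ = |z.re| := one_mul _
  unfold phiIntegrand
  rw [norm_div, norm_mul, norm_mul, norm_mul]
  have n4 : ‖(4 : ℂ)‖ = 4 := by norm_num
  rw [n4]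
  calc _ ≤ Real.exp |z.re| / (4 * ε * (Real.exp |z.re| * k₁) * (Real.exp (2 / r * |z.re|) * k₂)) := by
        gcongr
    _ = 1 / (4 * ε * k₁ * k₂) * Real.exp (-(2 / r) * |z.re|) := by
        rw [neg_mul, Real.exp_neg]
        field_simp
    _ ≤ _ := by
        gcongr
        exact Real.one_le_exp Real.pi_pos.le

theorem quantumDilog_eq_integral {r : ℕ} (hr : 3 ≤ r) {t : ℝ} (ht0 : 0 ≤ t) (ht1 : t ≤ 1) :
    Integrable (fun x : ℝ => phiIntegrand r t (x + Real.pi / 2 * I)) ∧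
      quantumDilog r t = ∫ x : ℝ, phiIntegrand r t (x + Real.pi / 2 * I) := by
  have hb : (0 : ℝ) < 2 / r := by
    have : 0 < r := by omega
    positivity
  have key : ∀ ε : ℝ, 0 < ε → ε ≤ 1 → _ := fun ε h0 h1 =>
    have ⟨C, hC⟩ := norm_phiIntegrand_le hr ht0 ht1 h0
    indented_integral_eq_shift h0 h1 hb (fun z => differentiableAt_phiIntegrand hr t) hC
  refine ⟨(key 1 one_pos le_rfl).1, ?_⟩
  refine Tendsto.limUnder_eq (tendsto_const_nhds.congr' ?_)
  filter_upwards [Ioc_mem_nhdsGT (zero_lt_one' ℝ)] with ε hε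
  exact (key ε hε.1 hε.2).2.symm

theorem phiIntegrand_sub {r : ℕ} (hr : 3 ≤ r) (a : ℝ) {z : ℂ} (hz : z ≠ 0)
    (him : |z.im| < Real.pi) :
    phiIntegrand r (a - 1 / r) z - phiIntegrand r (a + 1 / r) z =
      -(exp ((2 * a - 1) * z) / (2 * z * sinh z)) := by
  have h1 := sinh_ne_zero_of_abs_im_lt_pi hz him
  have h2 := sinh_two_mul_div_ne_zero hr hz him
  unfold phiIntegrand
  have e1 : (2 * ((a - 1 / r : ℝ) : ℂ) - 1) * z = (2 * a - 1) * z + -(2 * z / r) := by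
    push_cast; ring
  have e2 : (2 * ((a + 1 / r : ℝ) : ℂ) - 1) * z = (2 * a - 1) * z + 2 * z / r := by
    push_cast; ring
  have e3 : exp (2 * z / r) = exp (-(2 * z / r)) + 2 * sinh (2 * z / r) := by
    rw [two_sinh]; ring
  rw [e1, e2, exp_add, exp_add, e3]
  field_simp
  ring

theorem quantumDilog_difference_eq
    (r : ℕ) (hr : Odd r) (hr3 : 3 ≤ r) (a : ℝ)
    (ha₁ : 1 / r ≤ a) (ha₂ : a ≤ (r - 1) / r) :
    1 - Complex.exp (2 * Real.pi * I * a) =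
      Complex.exp (quantumDilog r (a - 1 / r) - quantumDilog r (a + 1 / r)) := by
  have hr0 : (0 : ℝ) < r := by
    have : 0 < r := by omega
    exact_mod_cast this
  have hinv : (0 : ℝ) < 1 / r := by positivity
  have ha₂' : a + 1 / r ≤ 1 := by
    have : ((r : ℝ) - 1) / r = 1 - 1 / r := by field_simp
    linarith
  have h0 : 0 < a := by linarith
  have h1 : a < 1 := by linarith
  obtain ⟨i1, e1⟩ := quantumDilog_eq_integral hr3 (t := a - 1 / r) (by linarith) (by linarith)
  obtain ⟨i2, e2⟩ := quantumDilog_eq_integral hr3 (t := a + 1 / r) (by linarith) (by linarith)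
  have hpt : ∀ x : ℝ, phiIntegrand r (a - 1 / r) (x + Real.pi / 2 * I) -
      phiIntegrand r (a + 1 / r) (x + Real.pi / 2 * I) =
      -(exp ((2 * a - 1) * (x + Real.pi / 2 * I)) /
        (2 * (x + Real.pi / 2 * I) * sinh (x + Real.pi / 2 * I))) := by
    intro x
    have him : ((x : ℂ) + Real.pi / 2 * I).im = Real.pi / 2 := by simp
    refine phiIntegrand_sub hr3 a ?_ ?_
    · intro h
      rw [h, zero_im] at him
      linarith [Real.pi_pos]
    · rw [him, abs_of_pos (by positivity)]
      linarith [Real.pi_pos]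
  rw [e1, e2, ← integral_sub i1 i2]
  simp_rw [hpt]
  rw [integral_neg, integral_exp_div_mul_sinh_eq h0 h1, neg_neg, exp_log]
  simpa using slitPlane_ne_zero (one_sub_mul_exp_mem_slitPlane h0 h1 (le_refl 0))
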